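/- For all positive integers m and n, the power series E(q^{mn})^{mn - m - n} E(q^m) E(q^n) / E(q) has nonnegative coefficients. -/

import Mathlib

/-- `E(q) = ∏_{n ≥ 1} (1 - qⁿ)`. -/
noncomputable def Eprod (q : ℂ) : ℂ := ∏' n : ℕ, (1 - q ^ (n + 1))

open Filter Topology

/-- The infinite `q`-Pochhammer symbol `(z; q)_∞ = ∏_{k ≥ 0} (1 - z q^k)`. -/
noncomputable def qPoch (z q : ℂ) : ℂ := ∏' k : ℕ, (1 - z * q ^ k)

section qPoch

variable {q : ℂ}

lemma norm_pow_lt_one (hq : ‖q‖ < 1) {k : ℕ} (hk : k ≠ 0) : ‖q ^ k‖ < 1 := by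
  rw [norm_pow]
  exact pow_lt_one₀ (norm_nonneg _) hq hk

lemma summable_norm_neg_mul_pow (hq : ‖q‖ < 1) (z : ℂ) :
    Summable fun k : ℕ => ‖-(z * q ^ k)‖ := by
  simpa using (summable_geometric_of_lt_one (norm_nonneg _) hq).mul_left ‖z‖

lemma tendsto_qPoch (hq : ‖q‖ < 1) (z : ℂ) :
    Tendsto (fun N => ∏ k ∈ Finset.range N, (1 - z * q ^ k)) atTop (𝓝 (qPoch z q)) := by
  have h := multipliable_one_add_of_summable (summable_norm_neg_mul_pow hq z)
  simp only [← sub_eq_add_neg] at h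
  exact h.hasProd.tendsto_prod_nat

lemma qPoch_ne_zero (hq : ‖q‖ < 1) {z : ℂ} (hz : ∀ k : ℕ, z * q ^ k ≠ 1) : qPoch z q ≠ 0 := by
  have h := tprod_one_add_ne_zero_of_summable (f := fun k : ℕ => -(z * q ^ k))
    (fun k => by rw [← sub_eq_add_neg]; exact sub_ne_zero.2 (hz k).symm)
    (summable_norm_neg_mul_pow hq z)
  simpa only [qPoch, ← sub_eq_add_neg] using h

lemma qPoch_ne_zero_of_norm_lt_one (hq : ‖q‖ < 1) {z : ℂ} (hz : ‖z‖ < 1) : qPoch z q ≠ 0 := by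
  refine qPoch_ne_zero hq fun k h => ?_
  have h1 : ‖z * q ^ k‖ < 1 := by
    rw [norm_mul, norm_pow]
    exact mul_lt_one_of_nonneg_of_lt_one_left (norm_nonneg _) hz
      (pow_le_one₀ (norm_nonneg _) hq.le)
  simp [h] at h1

lemma qPoch_self (q : ℂ) : qPoch q q = Eprod q := by
  simp only [qPoch, Eprod, pow_succ']

lemma Eprod_ne_zero (hq : ‖q‖ < 1) : Eprod q ≠ 0 :=
  qPoch_self q ▸ qPoch_ne_zero_of_norm_lt_one hq hq

lemma qPoch_eq_mul (hq : ‖q‖ < 1) (z : ℂ) : qPoch z q = (1 - z) * qPoch (z * q) q := by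
  refine tendsto_nhds_unique ((tendsto_add_atTop_iff_nat 1).2 (tendsto_qPoch hq z)) ?_
  refine ((tendsto_qPoch hq (z * q)).const_mul (1 - z)).congr fun N => ?_
  rw [Finset.prod_range_succ', pow_zero, mul_one, mul_comm]
  simp only [pow_succ', mul_assoc]

lemma prod_qPoch (hq : ‖q‖ < 1) (z : ℂ) {a : ℕ} (ha : a ≠ 0) :
    ∏ j ∈ Finset.range a, qPoch (z * q ^ j) (q ^ a) = qPoch z q := by
  have hqa := norm_pow_lt_one hq ha
  refine tendsto_nhds_unique
    (tendsto_finsetProd (Finset.range a) fun j _ => tendsto_qPoch hqa (z * q ^ j)) ?_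
  have h : Tendsto (fun N : ℕ => N * a) atTop atTop :=
    tendsto_id.atTop_mul_const' (Nat.pos_of_ne_zero ha)
  refine ((tendsto_qPoch hq z).comp h).congr fun N => ?_
  rw [Finset.prod_comm]
  simp only [Function.comp]
  induction N with
  | zero => simp
  | succ N ih =>
    rw [Nat.succ_mul, Finset.prod_range_add, ih, Finset.prod_range_succ]
    congr 1
    refine Finset.prod_congr rfl fun j _ => ?_
    rw [pow_add, ← pow_mul, mul_comm N a]
    ring

lemma continuous_qPoch (hq : ‖q‖ < 1) : Continuous fun z => qPoch z q := by
  rw [continuous_iff_continuousAt]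
  intro z₀
  have hopen : IsOpen (Metric.ball (0 : ℂ) (‖z₀‖ + 1)) := Metric.isOpen_ball
  have h := Summable.hasProdLocallyUniformlyOn_nat_one_add
    (f := fun (k : ℕ) (z : ℂ) => -(z * q ^ k)) hopen
    ((summable_geometric_of_lt_one (norm_nonneg _) hq).mul_left (‖z₀‖ + 1))
    (.of_forall fun k z hz => by
      rw [norm_neg, norm_mul, norm_pow]
      have : ‖z‖ < ‖z₀‖ + 1 := by simpa using hz
      gcongr) (fun _ => by fun_prop)
  have hc : ContinuousOn (fun z => qPoch z q) (Metric.ball (0 : ℂ) (‖z₀‖ + 1)) := by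
    have h2 := h.tendstoLocallyUniformlyOn_finsetRange.continuousOn
      (Frequently.of_forall fun n => by fun_prop)
    refine h2.congr fun z _ => ?_
    simp only [qPoch, sub_eq_add_neg]
  exact hc.continuousAt (hopen.mem_nhds (by simp))

end qPoch

/-- The triangular number `s (s - 1) / 2`. -/
def tri (s : ℤ) : ℤ := s * (s - 1) / 2

lemma two_mul_tri (s : ℤ) : 2 * tri s = s * (s - 1) :=
  Int.mul_ediv_cancel' (by simpa [mul_comm] using (Int.even_mul_pred_self s).two_dvd)

lemma tri_add_one (s : ℤ) : tri (s + 1) = tri s + s := by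
  have h1 := two_mul_tri s
  have h2 := two_mul_tri (s + 1)
  linarith [show (s + 1) * (s + 1 - 1) = s * (s - 1) + 2 * s by ring]

@[simp] lemma tri_zero : tri 0 = 0 := by decide

lemma tri_nonneg (s : ℤ) : 0 ≤ tri s := by
  have h := two_mul_tri s
  rcases le_or_gt s 0 with hs | hs <;> nlinarith

lemma eq_zpow_tri_mul {Q w : ℂ} (hQ : Q ≠ 0) (hw : w ≠ 0) {u : ℤ → ℂ}
    (hu : ∀ k, u (k + 1) = Q ^ k * w * u k) (k : ℤ) : u k = Q ^ tri k * w ^ k * u 0 := by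
  have hstep (k : ℤ) : Q ^ tri (k + 1) * w ^ (k + 1) = Q ^ k * w * (Q ^ tri k * w ^ k) := by
    rw [tri_add_one, zpow_add₀ hQ, zpow_add_one₀ hw]
    ring
  induction k using Int.induction_on with
  | zero => simp
  | succ k ih => rw [hu, ih, hstep]; ring
  | pred k ih =>
    have h1 := hu (-k - 1)
    have h2 := hstep (-k - 1)
    rw [sub_add_cancel] at h1 h2
    have h3 : Q ^ (-(k : ℤ) - 1) * w ≠ 0 := mul_ne_zero (zpow_ne_zero _ hQ) hw
    rw [h1, h2] at ih
    refine mul_left_cancel₀ h3 (ih.trans ?_)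
    ring

section JacobiTriple

variable {q w z : ℂ}

lemma summable_zpow_tri (hq : ‖q‖ < 1) (hq0 : q ≠ 0) (hw : w ≠ 0) :
    Summable fun s : ℤ => q ^ tri s * w ^ s := by
  have key (v : ℂ) (hv : v ≠ 0) : Summable fun n : ℕ => q ^ tri n * v ^ n := by
    refine summable_of_ratio_test_tendsto_lt_one (l := 0) one_pos
      (.of_forall fun n => mul_ne_zero (zpow_ne_zero _ hq0) (pow_ne_zero _ hv)) ?_
    have h := (tendsto_pow_atTop_nhds_zero_of_lt_one (norm_nonneg q) hq).mul_const ‖v‖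
    rw [zero_mul] at h
    refine h.congr fun n => ?_
    have h1 : q ^ tri n * v ^ n ≠ 0 := mul_ne_zero (zpow_ne_zero _ hq0) (pow_ne_zero _ hv)
    rw [← norm_div, ← norm_pow, ← norm_mul]
    congr 1
    rw [eq_div_iff h1, Nat.cast_succ, tri_add_one, zpow_add₀ hq0, zpow_natCast]
    ring
  refine .of_nat_of_neg (by simpa using key w hw) ?_
  refine (key (q * w⁻¹) (by simp [hq0, hw])).congr fun n => ?_
  have h : tri (-(n : ℤ)) = tri n + n := by
    linarith [two_mul_tri n, two_mul_tri (-(n : ℤ)),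
      show (-(n : ℤ)) * (-(n : ℤ) - 1) = n * (n - 1) + 2 * n by ring]
  rw [h, zpow_add₀ hq0, mul_pow, zpow_neg, zpow_natCast, zpow_natCast, inv_pow]
  ring

/-- `1 / (q; q)_n`, extended by zero to negative `n`. -/
noncomputable def invFac (q : ℂ) (n : ℤ) : ℂ :=
  if n < 0 then 0 else (∏ k ∈ Finset.range n.toNat, (1 - q * q ^ k))⁻¹

lemma invFac_of_neg {n : ℤ} (hn : n < 0) : invFac q n = 0 := if_pos hn

lemma invFac_natCast (n : ℕ) : invFac q n = (∏ k ∈ Finset.range n, (1 - q * q ^ k))⁻¹ := by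
  simp [invFac]

lemma one_sub_mul_pow_ne_zero (hq : ‖q‖ < 1) (k : ℕ) : 1 - q * q ^ k ≠ 0 := by
  intro h
  have h1 : ‖q ^ (k + 1)‖ < 1 := by
    rw [norm_pow]; exact pow_lt_one₀ (norm_nonneg _) hq k.succ_ne_zero
  rw [pow_succ', ← sub_eq_zero.1 h] at h1
  simp at h1

lemma invFac_eq (hq : ‖q‖ < 1) (n : ℤ) :
    invFac q n = (1 - q ^ (n + 1)) * invFac q (n + 1) := by
  rcases lt_trichotomy n (-1) with h | rfl | h
  · rw [invFac_of_neg (by omega), invFac_of_neg (by omega), mul_zero]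
  · simp [invFac_of_neg]
  · lift n to ℕ using by omega
    have h1 : q ^ ((n : ℤ) + 1) = q * q ^ n := by
      rw [← pow_succ']; norm_cast
    rw [h1, invFac_natCast, ← Nat.cast_succ, invFac_natCast, Finset.prod_range_succ]
    have := one_sub_mul_pow_ne_zero hq n
    field_simp

lemma tendsto_invFac (hq : ‖q‖ < 1) :
    Tendsto (fun n : ℕ => invFac q n) atTop (𝓝 (Eprod q)⁻¹) := by
  simp only [invFac_natCast]
  exact (qPoch_self q ▸ tendsto_qPoch hq q).inv₀ (Eprod_ne_zero hq)

lemma exists_norm_invFac_le (hq : ‖q‖ < 1) : ∃ C, ∀ n, ‖invFac q n‖ ≤ C := by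
  obtain ⟨C, hC⟩ := (tendsto_invFac hq).norm.bddAbove_range
  have hC' (n : ℕ) : ‖invFac q n‖ ≤ C := hC ⟨n, rfl⟩
  refine ⟨C, fun n => ?_⟩
  rcases lt_or_ge n 0 with hn | hn
  · rw [invFac_of_neg hn, norm_zero]
    exact (norm_nonneg _).trans (hC' 0)
  · lift n to ℕ using hn
    exact hC' n

/-- The coefficients of the finite form of the Jacobi triple product. -/
noncomputable def tripleCoeff (q : ℂ) (N : ℕ) (s : ℤ) : ℂ :=
  (∏ k ∈ Finset.range (2 * N), (1 - q * q ^ k)) * invFac q (N + s) * invFac q (N - s)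

lemma tripleCoeff_succ (hq : ‖q‖ < 1) (hq0 : q ≠ 0) (N : ℕ) (s : ℤ) :
    tripleCoeff q (N + 1) s = (1 + q ^ (2 * N + 1)) * tripleCoeff q N s +
      q ^ ((N : ℤ) - s + 1) * tripleCoeff q N (s - 1) +
      q ^ ((N : ℤ) + 1 + s) * tripleCoeff q N (s + 1) := by
  unfold tripleCoeff
  rw [show ((N + 1 : ℕ) : ℤ) + s = N + s + 1 by push_cast; ring,
    show ((N + 1 : ℕ) : ℤ) - s = N - s + 1 by push_cast; ring,
    show (N : ℤ) + (s - 1) = N + s - 1 by ring, show (N : ℤ) - (s - 1) = N - s + 1 by ring,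
    show (N : ℤ) + (s + 1) = N + s + 1 by ring, show (N : ℤ) - (s + 1) = N - s - 1 by ring,
    show (N : ℤ) + 1 + s = N + s + 1 by ring, invFac_eq hq (N + s - 1), invFac_eq hq (N - s - 1),
    sub_add_cancel, sub_add_cancel, invFac_eq hq (N + s), invFac_eq hq (N - s),
    show 2 * (N + 1) = 2 * N + 1 + 1 by ring, Finset.prod_range_succ, Finset.prod_range_succ]
  have h : q ^ (2 * N) = q ^ ((N : ℤ) + s) * q ^ ((N : ℤ) - s) := by
    rw [← zpow_add₀ hq0, ← zpow_natCast]
    congr 1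
    push_cast
    ring
  simp only [zpow_add_one₀ hq0, pow_succ, h]
  ring

lemma hasSum_finite_triple (hq : ‖q‖ < 1) (hq0 : q ≠ 0) (hw : w ≠ 0) (N : ℕ) :
    HasSum (fun s : ℤ => tripleCoeff q N s * (q ^ tri s * w ^ s))
      (∏ k ∈ Finset.range N, ((1 + w * q ^ k) * (1 + q / w * q ^ k))) := by
  induction N with
  | zero =>
    convert hasSum_single (f := fun s : ℤ => tripleCoeff q 0 s * (q ^ tri s * w ^ s)) 0 ?_ using 1
    · simp [tripleCoeff, invFac]
    · intro s hs
      rcases hs.lt_or_gt with h | h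
      · simp [tripleCoeff, invFac_of_neg h]
      · simp [tripleCoeff, invFac_of_neg (neg_lt_zero.2 h)]
  | succ N ih =>
    rw [Finset.prod_range_succ]
    have h1 := (Equiv.subRight (1 : ℤ)).hasSum_iff.2 ih
    have h2 := (Equiv.addRight (1 : ℤ)).hasSum_iff.2 ih
    have h := ((ih.mul_left (1 + q ^ (2 * N + 1))).add (h1.mul_left (w * q ^ N))).add
      (h2.mul_left (q / w * q ^ N))
    have hv : ∀ P : ℂ, P * ((1 + w * q ^ N) * (1 + q / w * q ^ N)) =
        (1 + q ^ (2 * N + 1)) * P + w * q ^ N * P + q / w * q ^ N * P := fun P => by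
      have := hw
      field_simp
      ring
    rw [hv]
    refine (congrArg (HasSum · _) (funext fun s => ?_)).mpr h
    have e1 : q ^ tri s = q ^ tri (s - 1) * q ^ s * q⁻¹ := by
      rw [mul_assoc, ← zpow_sub_one₀ hq0, ← zpow_add₀ hq0, ← tri_add_one, sub_add_cancel]
    have e2 : q ^ tri (s + 1) = q ^ tri s * q ^ s := by rw [tri_add_one, zpow_add₀ hq0]
    have e3 : w ^ s = w ^ (s - 1) * w := by rw [← zpow_add_one₀ hw, sub_add_cancel]
    rw [tripleCoeff_succ hq hq0]
    simp only [Function.comp, Equiv.subRight_apply, Equiv.coe_addRight]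
    rw [e2, zpow_add_one₀ hw, e1, e3, zpow_add₀ hq0, zpow_sub₀ hq0, zpow_add₀ hq0,
      zpow_add₀ hq0, zpow_natCast, zpow_one]
    have := zpow_ne_zero s hq0
    field_simp

/-- The **Jacobi triple product** identity. -/
theorem hasSum_jacobi_triple (hq : ‖q‖ < 1) (hq0 : q ≠ 0) (hw : w ≠ 0) :
    HasSum (fun s : ℤ => q ^ tri s * w ^ s) (Eprod q * (qPoch (-w) q * qPoch (q / -w) q)) := by
  have hs := summable_zpow_tri hq hq0 hw
  obtain ⟨C, hC⟩ := exists_norm_invFac_le hq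
  have hE := Eprod_ne_zero hq
  have hfac : Tendsto (fun n : ℕ => ∏ k ∈ Finset.range n, (1 - q * q ^ k)) atTop (𝓝 (Eprod q)) :=
    qPoch_self q ▸ tendsto_qPoch hq q
  have htwo : Tendsto (fun N : ℕ => 2 * N) atTop atTop :=
    tendsto_id.const_mul_atTop' two_pos
  have hfac2 := hfac.comp htwo
  obtain ⟨C', hC'⟩ := hfac2.norm.bddAbove_range
  have hC2 (N : ℕ) : ‖∏ k ∈ Finset.range (2 * N), (1 - q * q ^ k)‖ ≤ C' := hC' ⟨N, rfl⟩
  have hlim : Tendsto (fun N => ∑' s : ℤ, tripleCoeff q N s * (q ^ tri s * w ^ s)) atTop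
      (𝓝 (∑' s : ℤ, (Eprod q)⁻¹ * (q ^ tri s * w ^ s))) := by
    refine tendsto_tsum_of_dominated_convergence (hs.norm.mul_left (C' * C * C)) (fun s => ?_)
      (.of_forall fun N s => ?_)
    · refine Tendsto.mul_const _ ?_
      have h1 (t : ℤ) : Tendsto (fun N : ℕ => invFac q (N + t)) atTop (𝓝 (Eprod q)⁻¹) := by
        have h2 : Tendsto (fun N : ℕ => ((N : ℤ) + t).toNat) atTop atTop :=
          tendsto_atTop.2 fun b => by
            filter_upwards [eventually_ge_atTop (b + t.natAbs)] with N hN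
            omega
        refine ((tendsto_invFac hq).comp h2).congr' ?_
        filter_upwards [eventually_ge_atTop t.natAbs] with N hN
        simp only [Function.comp]
        rw [Int.toNat_of_nonneg (by omega)]
      have h3 := (hfac2.mul (h1 s)).mul (h1 (-s))
      rw [mul_inv_cancel₀ hE, one_mul] at h3
      exact h3
    · rw [norm_mul]
      refine mul_le_mul_of_nonneg_right ?_ (norm_nonneg _)
      have hC0 : 0 ≤ C := (norm_nonneg _).trans (hC 0)
      have hC0' : 0 ≤ C' := (norm_nonneg _).trans (hC2 0)
      rw [tripleCoeff, norm_mul, norm_mul]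
      gcongr
      exacts [hC2 N, hC _, hC _]
  have hprod : Tendsto (fun N => ∏ k ∈ Finset.range N, ((1 + w * q ^ k) * (1 + q / w * q ^ k)))
      atTop (𝓝 (qPoch (-w) q * qPoch (q / -w) q)) := by
    refine ((tendsto_qPoch hq _).mul (tendsto_qPoch hq _)).congr fun N => ?_
    rw [← Finset.prod_mul_distrib]
    refine Finset.prod_congr rfl fun k _ => ?_
    rw [div_neg]
    ring
  have h := tendsto_nhds_unique hprod
    (hlim.congr fun N => (hasSum_finite_triple hq hq0 hw N).tsum_eq)
  rw [h, tsum_mul_left, mul_inv_cancel_left₀ hE]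
  exact hs.hasSum

end JacobiTriple

section Sums

lemma hasSum_mul_prod {α β : Type*} {f : α → ℂ} {g : β → ℂ} {s t : ℂ} (hf : HasSum f s)
    (hg : HasSum g t) : HasSum (fun x : α × β => f x.1 * g x.2) (s * t) :=
  hf.mul hg (summable_mul_of_summable_norm hf.summable.norm hg.summable.norm)

lemma hasSum_prod_fin {n : ℕ} {f : Fin n → ℤ → ℂ} {s : Fin n → ℂ}
    (h : ∀ i, HasSum (f i) (s i)) :
    HasSum (fun x : Fin n → ℤ => ∏ i, f i (x i)) (∏ i, s i) := by
  induction n with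
  | zero => simp
  | succ n ih =>
    rw [Fin.prod_univ_succ, ← (Fin.consEquiv fun _ : Fin (n + 1) => ℤ).hasSum_iff]
    refine (congrArg (HasSum · _) (funext fun x => ?_)).mpr
      (hasSum_mul_prod (h 0) (ih fun i => h i.succ))
    simp [Fin.consEquiv, Fin.prod_univ_succ]

lemma hasSum_prod_univ {ι : Type*} [Fintype ι] {f : ι → ℤ → ℂ} {s : ι → ℂ}
    (h : ∀ i, HasSum (f i) (s i)) : HasSum (fun x : ι → ℤ => ∏ i, f i (x i)) (∏ i, s i) := by
  let e := Fintype.equivFin ι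
  have h1 := hasSum_prod_fin fun i => h (e.symm i)
  rw [e.symm.prod_comp s] at h1
  rw [← (e.arrowCongr (Equiv.refl ℤ)).symm.hasSum_iff]
  refine (congrArg (HasSum · _) (funext fun x => ?_)).mpr h1
  simp [← e.symm.prod_comp]

/-- Splitting a sum over `α` according to the value of an integer-valued function. -/
lemma hasSum_fiberwise_ite {α β : Type*} [DecidableEq β] {f : α → ℂ} {s : ℂ} (h : HasSum f s)
    (g : α → β) : HasSum (fun k => ∑' x, if g x = k then f x else 0) s := by
  refine (congrArg (HasSum · _) (funext fun k => ?_)).mpr (h.tsum_fiberwise g)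
  rw [tsum_subtype (g ⁻¹' {k}) f]
  refine tsum_congr fun x => ?_
  by_cases h : g x = k
  · rw [if_pos h, Set.indicator_of_mem (by exact h)]
  · rw [if_neg h, Set.indicator_of_notMem (by exact h)]

/-- The product of two absolutely convergent Laurent series. -/
lemma hasSum_laurent_mul {u v : ℤ → ℂ} {s t : ℂ} (hu : HasSum u s) (hv : HasSum v t) :
    HasSum (fun k => ∑' i, u i * v (k - i)) (s * t) := by
  have h := hasSum_mul_prod hu hv
  let e : ℤ × ℤ ≃ ℤ × ℤ :=
    { toFun := fun p => (p.2, p.1 - p.2)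
      invFun := fun p => (p.1 + p.2, p.1)
      left_inv := fun p => by simp
      right_inv := fun p => by simp }
  rw [← e.hasSum_iff] at h
  exact h.prod_fiberwise fun k => (h.summable.prod_factor k).hasSum

end Sums

lemma ZMod.val_eq_val_sub_one {a : ℕ} [NeZero a] (ρ : ZMod a) :
    (ρ.val : ℤ) = (ρ - 1).val + 1 - if ρ = 0 then (a : ℤ) else 0 := by
  have ha : (0 : ℤ) < a := by exact_mod_cast Nat.pos_of_ne_zero (NeZero.ne a)
  have h : ρ - 1 = (((ρ.val : ℤ) - 1 : ℤ) : ZMod a) := by simp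
  rw [h, ZMod.val_intCast]
  split_ifs with h0
  · have : (-1 : ℤ) % a = a - 1 := by
      rw [← Int.add_emod_right, Int.emod_eq_of_lt] <;> linarith
    simp [h0, this]
  · have h1 : ρ.val ≠ 0 := by rwa [Ne, ZMod.val_eq_zero]
    have h2 := ρ.val_lt
    rw [Int.emod_eq_of_lt (by lia) (by lia)]
    ring

lemma ZMod.intCast_val_ediv {a : ℕ} [NeZero a] (k : ℤ) :
    (((k : ZMod a).val : ℕ) : ℤ) + a * (k / a) = k := by
  rw [ZMod.val_intCast, Int.emod_add_mul_ediv]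

lemma ZMod.prod_val_eq_prod_range {a : ℕ} [NeZero a] (f : ℕ → ℂ) :
    ∏ ρ : ZMod a, f ρ.val = ∏ j ∈ Finset.range a, f j := by
  cases a with
  | zero => exact absurd rfl (NeZero.ne 0)
  | succ n => exact Fin.prod_univ_eq_prod_range f (n + 1)

lemma zpow_sum₀ {ι : Type*} {q : ℂ} (hq0 : q ≠ 0) (s : Finset ι) (f : ι → ℤ) :
    q ^ (∑ i ∈ s, f i) = ∏ i ∈ s, q ^ f i := by
  classical
  induction s using Finset.induction_on with
  | empty => simp
  | insert i s hi ih => rw [Finset.sum_insert hi, Finset.prod_insert hi, zpow_add₀ hq0, ih]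

section Lattice

variable {a : ℕ}

/-- Translation of all positions by `1`. -/
def latShift : (ZMod a → ℤ) ≃ (ZMod a → ℤ) :=
  ((Equiv.addRight (1 : ZMod a)).arrowCongr (Equiv.refl ℤ)).trans (Equiv.addRight (Pi.single 0 1))

lemma latShift_apply (x : ZMod a → ℤ) (ρ : ZMod a) :
    latShift x ρ = x (ρ - 1) + if ρ = 0 then 1 else 0 := by
  simp [latShift, Pi.single_apply, sub_eq_add_neg]

/-- The charge-preserving bijection that moves one position in residue class `ρ`. -/
def latMove (ρ : ZMod a) : (ZMod a → ℤ) ≃ (ZMod a → ℤ) :=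
  (Equiv.addRight (Pi.single ρ 1)).trans latShift.symm

lemma latShift_latMove (ρ : ZMod a) (x : ZMod a → ℤ) :
    latShift (latMove ρ x) = x + Pi.single ρ 1 := by
  simp [latMove]

variable [NeZero a]

/-- The position in residue class `ρ` of a beta-set with charges `x`. -/
def latPos (x : ZMod a → ℤ) (ρ : ZMod a) : ℤ := a * x ρ + ρ.val

/-- The quadratic form attached to the charges `x`. -/
def latEnergy (x : ZMod a → ℤ) : ℤ := ∑ ρ, (a * tri (x ρ) + ρ.val * x ρ)

lemma latEnergy_nonneg (x : ZMod a → ℤ) : 0 ≤ latEnergy x := by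
  refine Finset.sum_nonneg fun ρ _ => ?_
  have h1 := two_mul_tri (x ρ)
  have h2 : (ρ.val : ℤ) ≤ a := by exact_mod_cast ρ.val_lt.le
  have h3 : (0 : ℤ) ≤ ρ.val := by positivity
  rcases le_or_gt 0 (x ρ) with h | h
  · have := tri_nonneg (x ρ)
    positivity
  · have h4 : 0 ≤ tri (x ρ + 1) := tri_nonneg _
    rw [tri_add_one] at h4
    nlinarith

lemma latPos_add_single (x : ZMod a → ℤ) (ρ : ZMod a) :
    latPos (x + Pi.single ρ 1) ρ = latPos x ρ + a := by
  simp [latPos]; ring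

lemma sum_add_single (x : ZMod a → ℤ) (ρ : ZMod a) :
    ∑ σ, (x + Pi.single ρ 1 : ZMod a → ℤ) σ = ∑ σ, x σ + 1 := by
  simp [Finset.sum_add_distrib]

lemma latEnergy_add_single (x : ZMod a → ℤ) (ρ : ZMod a) :
    latEnergy (x + Pi.single ρ 1) = latEnergy x + latPos x ρ := by
  simp only [latEnergy, latPos, ← Finset.add_sum_erase _ _ (Finset.mem_univ ρ)]
  have h : ∑ σ ∈ Finset.univ.erase ρ, (a * tri ((x + Pi.single ρ 1 : ZMod a → ℤ) σ) +
      σ.val * (x + Pi.single ρ 1 : ZMod a → ℤ) σ) =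
      ∑ σ ∈ Finset.univ.erase ρ, (a * tri (x σ) + σ.val * x σ) := by
    refine Finset.sum_congr rfl fun σ hσ => ?_
    simp [Finset.ne_of_mem_erase hσ]
  rw [h]
  simp only [Pi.add_apply, Pi.single_eq_same, tri_add_one]
  ring

lemma sum_latShift (x : ZMod a → ℤ) : ∑ ρ, latShift x ρ = ∑ ρ, x ρ + 1 := by
  simp only [latShift_apply, Finset.sum_add_distrib, Finset.sum_ite_eq', Finset.mem_univ, if_true]
  exact congrArg (· + 1) ((Equiv.subRight (1 : ZMod a)).sum_comp x)

lemma latPos_latShift (x : ZMod a → ℤ) (ρ : ZMod a) :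
    latPos (latShift x) ρ = latPos x (ρ - 1) + 1 := by
  simp only [latPos, latShift_apply, ZMod.val_eq_val_sub_one ρ]
  split_ifs <;> ring

lemma latEnergy_latShift (x : ZMod a → ℤ) :
    latEnergy (latShift x) = latEnergy x + ∑ ρ, x ρ := by
  rw [latEnergy, latEnergy, ← Finset.sum_add_distrib,
    ← (Equiv.subRight (1 : ZMod a)).sum_comp fun ρ => a * tri (x ρ) + ρ.val * x ρ + x ρ]
  refine Finset.sum_congr rfl fun ρ _ => ?_
  have h := ZMod.val_eq_val_sub_one ρ
  simp only [latShift_apply, Equiv.subRight_apply]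
  split_ifs at h ⊢ with h0
  · rw [h0, ZMod.val_zero, Nat.cast_zero] at h
    rw [tri_add_one, h0, ZMod.val_zero, Nat.cast_zero]
    linear_combination x (0 - 1) * h
  · rw [h]
    ring_nf

lemma sum_latMove (ρ : ZMod a) (x : ZMod a → ℤ) : ∑ σ, latMove ρ x σ = ∑ σ, x σ := by
  have h := sum_latShift (latMove ρ x)
  rw [latShift_latMove, sum_add_single] at h
  linarith

lemma latPos_latMove (ρ : ZMod a) (x : ZMod a → ℤ) :
    latPos (latMove ρ x) (ρ - 1) = latPos x ρ + a - 1 := by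
  have h := latPos_latShift (latMove ρ x) ρ
  rw [latShift_latMove, latPos_add_single] at h
  linarith

lemma latEnergy_latMove (ρ : ZMod a) {x : ZMod a → ℤ} (hx : ∑ σ, x σ = 0) :
    latEnergy (latMove ρ x) = latEnergy x + latPos x ρ := by
  have h := latEnergy_latShift (latMove ρ x)
  rw [latShift_latMove, latEnergy_add_single, sum_latMove, hx] at h
  linarith

variable {q z : ℂ}

lemma norm_pow_self_lt_one (hq : ‖q‖ < 1) : ‖q ^ a‖ < 1 :=
  norm_pow_lt_one hq (NeZero.ne a)

lemma hasSum_latEnergy (hq : ‖q‖ < 1) (hq0 : q ≠ 0) {w : ZMod a → ℂ} (hw : ∀ ρ, w ρ ≠ 0) :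
    HasSum (fun x : ZMod a → ℤ => q ^ latEnergy x * ∏ ρ, w ρ ^ x ρ)
      (∏ ρ, Eprod (q ^ a) *
        (qPoch (-(q ^ ρ.val * w ρ)) (q ^ a) * qPoch (q ^ a / -(q ^ ρ.val * w ρ)) (q ^ a))) := by
  refine (congrArg (HasSum · _) (funext fun x => ?_)).mpr
    (hasSum_prod_univ fun ρ : ZMod a => hasSum_jacobi_triple (norm_pow_self_lt_one (a := a) hq)
      (pow_ne_zero a hq0) (mul_ne_zero (pow_ne_zero ρ.val hq0) (hw ρ)))
  rw [latEnergy, zpow_sum₀ hq0, ← Finset.prod_mul_distrib]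
  refine Finset.prod_congr rfl fun ρ _ => ?_
  rw [zpow_add₀ hq0, zpow_mul, zpow_mul, mul_zpow, zpow_natCast, zpow_natCast, mul_assoc]

end Lattice

section LatticeSums

variable {a : ℕ} [NeZero a] {q z : ℂ}

/-- The weight of the neutral charge vectors. -/
noncomputable def latWeight (q : ℂ) (x : ZMod a → ℤ) : ℂ :=
  if ∑ ρ, x ρ = 0 then q ^ latEnergy x else 0

variable (a) in
/-- The generating function of the neutral charge vectors. -/
noncomputable def latConst (q : ℂ) : ℂ := ∑' x : ZMod a → ℤ, latWeight q x

variable (a) in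
/-- The generating function of the neutral charge vectors with a marked position. -/
noncomputable def latTheta (q z : ℂ) : ℂ :=
  ∑ ρ : ZMod a, ∑' x : ZMod a → ℤ, latWeight q x * z ^ latPos x ρ

variable (a) in
/-- The generating function of the neutral charge vectors with marked position `k`. -/
noncomputable def latCoeff (q : ℂ) (k : ℤ) : ℂ :=
  ∑' x : ZMod a → ℤ, if latPos x k = k then latWeight q x else 0

lemma summable_latWeight_mul (hq : ‖q‖ < 1) (hq0 : q ≠ 0) (hz : z ≠ 0) (ρ : ZMod a) :
    Summable fun x : ZMod a → ℤ => latWeight q x * z ^ latPos x ρ := by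
  have hw (σ : ZMod a) : Function.update (1 : ZMod a → ℂ) ρ (z ^ a) σ ≠ 0 := by
    rcases eq_or_ne σ ρ with rfl | h
    · simpa using pow_ne_zero a hz
    · simp [h]
  have h := ((hasSum_latEnergy hq hq0 hw).summable.mul_right (z ^ (ρ.val : ℤ))).norm
  refine Summable.of_norm_bounded h fun x => ?_
  have h1 : ∏ σ, Function.update (1 : ZMod a → ℂ) ρ (z ^ a) σ ^ x σ = z ^ (a * x ρ) := by
    rw [Finset.prod_eq_single ρ (fun σ _ hσ => by simp [hσ]) (by simp), Function.update_self,
      zpow_mul, zpow_natCast]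
  rw [h1, mul_assoc, ← zpow_add₀ hz, latWeight, latPos]
  split_ifs
  · exact le_rfl
  · rw [zero_mul, norm_zero]
    exact norm_nonneg _

lemma summable_latWeight (hq : ‖q‖ < 1) (hq0 : q ≠ 0) :
    Summable fun x : ZMod a → ℤ => latWeight q x := by
  simpa using summable_latWeight_mul hq hq0 one_ne_zero (0 : ZMod a)

lemma latConst_mul_Eprod (hq : ‖q‖ < 1) (hq0 : q ≠ 0) :
    latConst a q * Eprod q = Eprod (q ^ a) ^ a := by
  have ha : a ≠ 0 := NeZero.ne a
  let T (k : ℤ) : ℂ := ∑' x : ZMod a → ℤ, if ∑ ρ, x ρ = k then q ^ latEnergy x else 0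
  have hT (k : ℤ) : T (k + 1) = q ^ k * 1 * T k := by
    simp only [T]
    rw [← tsum_mul_left, ← latShift.tsum_eq]
    refine tsum_congr fun x => ?_
    rw [sum_latShift, latEnergy_latShift]
    by_cases h : ∑ ρ, x ρ = k
    · rw [if_pos h, if_pos (by rw [h]), h, zpow_add₀ hq0]
      ring
    · rw [if_neg h, if_neg (by simpa using h), mul_zero]
  have hsum := hasSum_latEnergy (a := a) hq hq0 (w := fun _ => 1) fun _ => one_ne_zero
  simp only [one_zpow, Finset.prod_const_one, mul_one, Finset.prod_mul_distrib] at hsum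
  have h1 := hasSum_fiberwise_ite hsum fun x => ∑ ρ, x ρ
  have h2 := (hasSum_jacobi_triple hq hq0 one_ne_zero).mul_left (latConst a q)
  have h3 : (fun k : ℤ => ∑' x : ZMod a → ℤ, if ∑ ρ, x ρ = k then q ^ latEnergy x else 0) =
      fun k : ℤ => latConst a q * (q ^ tri k * 1 ^ k) := by
    funext k
    rw [mul_comm]
    exact eq_zpow_tri_mul hq0 one_ne_zero hT k
  rw [h3] at h1
  have h4 := h1.unique h2
  have h5 : ∏ ρ : ZMod a, qPoch (-q ^ ρ.val) (q ^ a) = qPoch (-1) q := by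
    rw [ZMod.prod_val_eq_prod_range fun j => qPoch (-q ^ j) (q ^ a), ← prod_qPoch hq (-1) ha]
    simp only [neg_mul, one_mul]
  have h6 : ∏ ρ : ZMod a, qPoch (q ^ a / -q ^ ρ.val) (q ^ a) = qPoch (q / -1) q := by
    rw [ZMod.prod_val_eq_prod_range fun j => qPoch (q ^ a / -q ^ j) (q ^ a),
      ← prod_qPoch hq (q / -1) ha, ← Finset.prod_range_reflect]
    refine Finset.prod_congr rfl fun j hj => congrArg (qPoch · _) ?_
    have hj' := Finset.mem_range.1 hj
    rw [div_neg, div_neg, div_one, neg_mul, ← pow_succ', neg_inj, div_eq_iff (pow_ne_zero _ hq0),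
      ← pow_add]
    congr 1
    lia
  rw [h5, h6, Finset.prod_const, Finset.card_univ, ZMod.card] at h4
  have h7 : qPoch (-1) q * qPoch (q / -1) q ≠ 0 := by
    refine mul_ne_zero ?_ (qPoch_ne_zero_of_norm_lt_one hq (by simpa using hq))
    rw [qPoch_eq_mul hq]
    exact mul_ne_zero (by norm_num) (qPoch_ne_zero_of_norm_lt_one hq (by simpa using hq))
  refine mul_right_cancel₀ h7 ?_
  rw [h4, mul_assoc]

lemma latCoeff_add (hq0 : q ≠ 0) (k : ℤ) :
    latCoeff a q (k + a - 1) = q ^ k * latCoeff a q k := by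
  rw [latCoeff, latCoeff, ← tsum_mul_left, ← (latMove (k : ZMod a)).tsum_eq]
  refine tsum_congr fun x => ?_
  have h : ((k + a - 1 : ℤ) : ZMod a) = (k : ZMod a) - 1 := by simp
  rw [h, latPos_latMove]
  by_cases hk : latPos x k = k
  · rw [if_pos hk, if_pos (by rw [hk]), latWeight, latWeight, sum_latMove]
    split_ifs with h0
    · rw [latEnergy_latMove _ h0, zpow_add₀ hq0, hk, mul_comm]
    · rw [mul_zero]
  · rw [if_neg hk, if_neg (by lia), mul_zero]

lemma hasSum_latCoeff_add_mul (hq : ‖q‖ < 1) (hq0 : q ≠ 0) (i : ℤ) :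
    HasSum (fun t : ℤ => latCoeff a q (i + a * t)) (latConst a q) := by
  refine (congrArg (HasSum · _) (funext fun t => ?_)).mpr
    (hasSum_fiberwise_ite (summable_latWeight (a := a) hq hq0).hasSum fun x => x i - i / a)
  have ha : (a : ℤ) ≠ 0 := by exact_mod_cast NeZero.ne a
  have h := ZMod.intCast_val_ediv (a := a) i
  refine tsum_congr fun x => ?_
  have h1 : ((i + a * t : ℤ) : ZMod a) = (i : ZMod a) := by simp
  rw [h1, latPos]
  refine if_congr ?_ rfl rfl
  rw [← mul_right_inj' ha (b := x i - i / a)]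
  constructor <;> intro h2 <;> linarith

lemma hasSum_latCoeff_mul (hq : ‖q‖ < 1) (hq0 : q ≠ 0) (hz : z ≠ 0) :
    HasSum (fun k : ℤ => latCoeff a q k * z ^ k) (latTheta a q z) := by
  have h := hasSum_sum (s := Finset.univ) fun (ρ : ZMod a) _ =>
    hasSum_fiberwise_ite (summable_latWeight_mul hq hq0 hz ρ).hasSum fun x => latPos x ρ
  refine (congrArg (HasSum · _) (funext fun k => ?_)).mpr h
  rw [Finset.sum_eq_single (k : ZMod a), latCoeff, ← tsum_mul_right]
  · refine tsum_congr fun x => ?_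
    split_ifs with hk
    · rw [hk]
    · rw [zero_mul]
  · intro ρ _ hρ
    refine (tsum_congr fun x => if_neg fun hk => hρ ?_).trans tsum_zero
    rw [← hk]
    simp [latPos]
  · simp

end LatticeSums

/-- The theta product `(z; q)_∞ (q / z; q)_∞`. -/
noncomputable def thetaProd (z q : ℂ) : ℂ := qPoch z q * qPoch (q / z) q

section ThetaIdentity

variable {q z : ℂ}

lemma hasSum_thetaProd (hq : ‖q‖ < 1) (hq0 : q ≠ 0) (hz : z ≠ 0) :
    HasSum (fun s : ℤ => (-1) ^ s * q ^ tri s * z ^ s) (Eprod q * thetaProd z q) := by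
  have h := hasSum_jacobi_triple hq hq0 (neg_ne_zero.2 hz)
  rw [neg_neg] at h
  refine (congrArg (HasSum · _) (funext fun s => ?_)).mpr h
  rw [← neg_one_mul z, mul_zpow]
  ring

lemma thetaProd_one (hq : ‖q‖ < 1) : thetaProd 1 q = 0 := by
  rw [thetaProd, qPoch_eq_mul hq]; simp

variable {a : ℕ} [NeZero a]

variable (a) in
/-- The coefficients of the product of `latTheta` and the theta series. -/
noncomputable def convCoeff (q : ℂ) (k : ℤ) : ℂ :=
  ∑' s : ℤ, (-1) ^ s * q ^ tri s * latCoeff a q (k - s)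

lemma hasSum_convCoeff (hq : ‖q‖ < 1) (hq0 : q ≠ 0) (hz : z ≠ 0) :
    HasSum (fun k : ℤ => convCoeff a q k * z ^ k) (Eprod q * thetaProd z q * latTheta a q z) := by
  refine (congrArg (HasSum · _) (funext fun k => ?_)).mpr
    (hasSum_laurent_mul (hasSum_thetaProd hq hq0 hz) (hasSum_latCoeff_mul (a := a) hq hq0 hz))
  rw [convCoeff, ← tsum_mul_right]
  refine tsum_congr fun s => ?_
  rw [zpow_sub₀ hz]
  have := zpow_ne_zero s hz
  field_simp

lemma convCoeff_add (hq0 : q ≠ 0) (k : ℤ) :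
    convCoeff a q (k + a) = -q ^ k * convCoeff a q k := by
  rw [convCoeff, convCoeff, ← tsum_mul_left, ← (Equiv.addRight (1 : ℤ)).tsum_eq]
  refine tsum_congr fun s => ?_
  have h : k + a - (s + 1) = (k - s) + a - 1 := by ring
  rw [Equiv.coe_addRight, h, latCoeff_add hq0, tri_add_one, zpow_add₀ hq0, zpow_sub₀ hq0,
    zpow_add_one₀ (by norm_num)]
  have := zpow_ne_zero s hq0
  field_simp

lemma convCoeff_add_mul (hq0 : q ≠ 0) (j t : ℤ) :
    convCoeff a q (j + a * t) = (q ^ a) ^ tri t * (-q ^ j) ^ t * convCoeff a q j := by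
  have h := eq_zpow_tri_mul (pow_ne_zero a hq0) (neg_ne_zero.2 (zpow_ne_zero j hq0))
    (u := fun t => convCoeff a q (j + a * t)) (fun t => by
      have h : j + a * (t + 1) = j + a * t + a := by ring
      rw [h, convCoeff_add hq0, zpow_add₀ hq0, zpow_mul, zpow_natCast]
      ring) t
  simpa using h

lemma hasSum_convCoeff_add_mul (hq : ‖q‖ < 1) (hq0 : q ≠ 0) (hz : z ≠ 0) (j : ℤ) :
    HasSum (fun t : ℤ => convCoeff a q (j + a * t) * (z ^ a) ^ t)
      (convCoeff a q j * (Eprod (q ^ a) * thetaProd (q ^ j * z ^ a) (q ^ a))) := by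
  refine (congrArg (HasSum · _) (funext fun t => ?_)).mpr
    ((hasSum_thetaProd (norm_pow_self_lt_one (a := a) hq) (pow_ne_zero a hq0)
      (mul_ne_zero (zpow_ne_zero j hq0) (pow_ne_zero a hz))).mul_left (convCoeff a q j))
  rw [convCoeff_add_mul hq0, neg_eq_neg_one_mul, mul_zpow, mul_zpow]
  ring

lemma tsum_convCoeff_add_mul (hq : ‖q‖ < 1) (hq0 : q ≠ 0) (j : ℤ) :
    ∑' t : ℤ, convCoeff a q (j + a * t) = 0 := by
  have ha : (a : ℤ) ≠ 0 := by exact_mod_cast NeZero.ne a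
  have h1 := (hasSum_thetaProd hq hq0 one_ne_zero).mul_right (latConst a q)
  simp only [one_zpow, mul_one, thetaProd_one hq, mul_zero, zero_mul] at h1
  have h2 : Summable fun p : ℤ × ℤ =>
      (-1) ^ p.2 * q ^ tri p.2 * latCoeff a q (j + a * p.1 - p.2) := by
    have h := (hasSum_mul_prod (hasSum_thetaProd hq hq0 one_ne_zero)
      (hasSum_latCoeff_mul (a := a) hq hq0 one_ne_zero)).summable
    simp only [one_zpow, mul_one] at h
    refine h.comp_injective (i := fun p : ℤ × ℤ => (p.2, j + a * p.1 - p.2)) fun p p' hp => ?_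
    simp only [Prod.mk.injEq] at hp
    refine Prod.ext (mul_left_cancel₀ ha ?_) hp.1
    linarith [hp.1, hp.2]
  simp only [convCoeff]
  rw [← Summable.tsum_comm (f := fun t s : ℤ =>
    (-1) ^ s * q ^ tri s * latCoeff a q (j + a * t - s)) h2, ← h1.tsum_eq]
  refine tsum_congr fun s => ?_
  rw [tsum_mul_left, ← (hasSum_latCoeff_add_mul (a := a) hq hq0 (j - s)).tsum_eq]
  refine congrArg _ (tsum_congr fun t => ?_)
  congr 1
  ring

lemma convCoeff_eq_zero (hq : ‖q‖ < 1) (hq0 : q ≠ 0) {j : ℕ} (hj : 0 < j) (hja : j < a) :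
    convCoeff a q j = 0 := by
  have hqa := norm_pow_self_lt_one (a := a) hq
  have h := (hasSum_convCoeff_add_mul (a := a) hq hq0 one_ne_zero j).tsum_eq
  simp only [one_pow, one_zpow, mul_one, tsum_convCoeff_add_mul hq hq0, zpow_natCast] at h
  have h2 : thetaProd (q ^ j) (q ^ a) ≠ 0 := by
    refine mul_ne_zero (qPoch_ne_zero_of_norm_lt_one hqa (norm_pow_lt_one hq hj.ne'))
      (qPoch_ne_zero_of_norm_lt_one hqa ?_)
    rw [div_eq_mul_inv, ← pow_sub₀ _ hq0 hja.le]
    exact norm_pow_lt_one hq (by lia)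
  exact (mul_eq_zero.1 h.symm).resolve_right (mul_ne_zero (Eprod_ne_zero hqa) h2)

lemma thetaProd_mul_latTheta (hq : ‖q‖ < 1) (hq0 : q ≠ 0) (hz : z ≠ 0) :
    Eprod q * thetaProd z q * latTheta a q z =
      convCoeff a q 0 * (Eprod (q ^ a) * thetaProd (z ^ a) (q ^ a)) := by
  have ha : (a : ℤ) ≠ 0 := by exact_mod_cast NeZero.ne a
  have h0 := hasSum_convCoeff_add_mul (a := a) hq hq0 hz 0
  rw [zpow_zero, one_mul] at h0
  refine (hasSum_convCoeff (a := a) hq hq0 hz).unique ?_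
  have hinj : Function.Injective fun t : ℤ => (a : ℤ) * t := mul_right_injective₀ ha
  refine (hinj.hasSum_iff fun k hk => ?_).1
    ((congrArg (HasSum · _) (funext fun t => ?_)).mpr h0)
  · have h1 := ZMod.intCast_val_ediv (a := a) k
    have h2 : (k : ZMod a).val ≠ 0 := fun h => hk ⟨k / a, by simpa [h] using h1⟩
    rw [← h1, convCoeff_add_mul hq0,
      convCoeff_eq_zero hq hq0 (Nat.pos_of_ne_zero h2) (ZMod.val_lt _), mul_zero, zero_mul]
  · simp only [Function.comp, zero_add]
    rw [zpow_mul, zpow_natCast]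

end ThetaIdentity

section ThetaConstant

variable {q z : ℂ} {a : ℕ} [NeZero a]

lemma zpow_le_add_zpow {r : ℝ} (h1 : 1 / 2 ≤ r) (h2 : r ≤ 2) (k : ℤ) :
    r ^ k ≤ 2 ^ k + (1 / 2) ^ k := by
  have hr : 0 < r := by linarith
  rcases le_total 0 k with hk | hk
  · lift k to ℕ using hk
    simp only [zpow_natCast]
    have := pow_le_pow_left₀ hr.le h2 k
    have : (0 : ℝ) ≤ (1 / 2) ^ k := by positivity
    linarith
  · obtain ⟨n, rfl⟩ : ∃ n : ℕ, k = -n := ⟨k.natAbs, by lia⟩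
    simp only [zpow_neg, zpow_natCast]
    have : (r ^ n)⁻¹ ≤ ((1 / 2) ^ n)⁻¹ := by gcongr
    have : (0 : ℝ) ≤ (2 ^ n)⁻¹ := by positivity
    linarith

lemma continuousAt_latTheta_one (hq : ‖q‖ < 1) (hq0 : q ≠ 0) :
    ContinuousAt (latTheta a q) 1 := by
  refine tendsto_finsetSum _ fun ρ _ => ?_
  have h2 := (summable_latWeight_mul hq hq0 two_ne_zero ρ).norm
  have h3 := (summable_latWeight_mul hq hq0 (z := 1 / 2) (by norm_num) ρ).norm
  have hn : ContinuousAt (fun z : ℂ => ‖z‖) 1 := continuous_norm.continuousAt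
  refine tendsto_tsum_of_dominated_convergence (h2.add h3)
    (fun x => ((continuousAt_zpow₀ 1 _ (.inl one_ne_zero)).tendsto).const_mul _) ?_
  filter_upwards [hn.eventually (Icc_mem_nhds (a := 1 / 2) (b := 2) (by simp; norm_num) (by simp))]
    with z hz x
  simp only [norm_mul, norm_zpow, ← mul_add]
  refine mul_le_mul_of_nonneg_left ?_ (norm_nonneg _)
  simpa using zpow_le_add_zpow hz.1 hz.2 (latPos x ρ)

lemma latTheta_one : latTheta a q 1 = a * latConst a q := by
  simp [latTheta, latConst, ZMod.card]

lemma thetaProd_eq_mul (hq : ‖q‖ < 1) (z : ℂ) :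
    thetaProd z q = (1 - z) * (qPoch (z * q) q * qPoch (q / z) q) := by
  rw [thetaProd, qPoch_eq_mul hq, mul_assoc]

lemma tendsto_thetaProd_div (hq : ‖q‖ < 1) :
    Tendsto (fun z => qPoch (z * q) q * qPoch (q / z) q) (𝓝 1) (𝓝 (Eprod q ^ 2)) := by
  have hc := continuous_qPoch hq
  have h : ContinuousAt (fun z => qPoch (z * q) q * qPoch (q / z) q) 1 :=
    (hc.comp (continuous_id.mul_const q)).continuousAt.mul
      (hc.continuousAt.comp (continuousAt_const.div continuousAt_id one_ne_zero))
  simpa [ContinuousAt, qPoch_self, sq] using h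

lemma convCoeff_zero_mul (hq : ‖q‖ < 1) (hq0 : q ≠ 0) :
    convCoeff a q 0 * Eprod (q ^ a) ^ 3 = latConst a q * Eprod q ^ 3 := by
  have hqa := norm_pow_self_lt_one (a := a) hq
  have h1 : Tendsto (fun z => Eprod q * (qPoch (z * q) q * qPoch (q / z) q) * latTheta a q z)
      (𝓝[≠] 1) (𝓝 (Eprod q * Eprod q ^ 2 * latTheta a q 1)) :=
    (((tendsto_thetaProd_div hq).const_mul _).mul
      (continuousAt_latTheta_one hq hq0).tendsto).mono_left nhdsWithin_le_nhds
  have hp : Tendsto (fun z : ℂ => z ^ a) (𝓝 1) (𝓝 1) := by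
    simpa using (continuous_pow (M := ℂ) a).tendsto 1
  have hg : Tendsto (fun z : ℂ => ∑ i ∈ Finset.range a, z ^ i) (𝓝 1) (𝓝 a) := by
    have : Continuous fun z : ℂ => ∑ i ∈ Finset.range a, z ^ i := by fun_prop
    simpa using this.tendsto 1
  have h2 : Tendsto (fun z => convCoeff a q 0 * (Eprod (q ^ a) *
      ((∑ i ∈ Finset.range a, z ^ i) *
        (qPoch (z ^ a * q ^ a) (q ^ a) * qPoch (q ^ a / z ^ a) (q ^ a)))))
      (𝓝[≠] 1) (𝓝 (convCoeff a q 0 * (Eprod (q ^ a) * (a * Eprod (q ^ a) ^ 2)))) :=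
    (((hg.mul ((tendsto_thetaProd_div hqa).comp hp)).const_mul _).const_mul _).mono_left
      nhdsWithin_le_nhds
  have h3 := tendsto_nhds_unique (h2.congr' ?_) h1
  · rw [latTheta_one] at h3
    have ha : (a : ℂ) ≠ 0 := by exact_mod_cast NeZero.ne a
    refine mul_left_cancel₀ ha ?_
    linear_combination h3
  · have h0 : ∀ᶠ z : ℂ in 𝓝[≠] 1, z ≠ 0 :=
      nhdsWithin_le_nhds (isOpen_ne.mem_nhds one_ne_zero)
    filter_upwards [self_mem_nhdsWithin, h0] with z hz1 hz0
    have hz : (1 - z : ℂ) ≠ 0 := sub_ne_zero.2 (Ne.symm hz1)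
    have h := thetaProd_mul_latTheta (a := a) hq hq0 hz0
    rw [thetaProd_eq_mul hq, thetaProd_eq_mul hqa, ← mul_neg_geom_sum] at h
    refine mul_left_cancel₀ hz ?_
    linear_combination -h

/-- The key identity: the theta-type generating function is a quotient of theta products. -/
lemma latTheta_mul_latConst (hq : ‖q‖ < 1) (hq0 : q ≠ 0) (hz : z ≠ 0) :
    latTheta a q z * latConst a q * thetaProd z q * Eprod (q ^ a) ^ 2 =
      Eprod (q ^ a) ^ (2 * a) * thetaProd (z ^ a) (q ^ a) := by
  have h1 := thetaProd_mul_latTheta (a := a) hq hq0 hz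
  have h2 := convCoeff_zero_mul (a := a) hq hq0
  have h3 := latConst_mul_Eprod (a := a) hq hq0
  have hE := Eprod_ne_zero hq
  have hEa := Eprod_ne_zero (norm_pow_self_lt_one (a := a) hq)
  rw [mul_comm 2 a, pow_mul, ← h3]
  refine mul_left_cancel₀ hE ?_
  linear_combination latConst a q * Eprod (q ^ a) ^ 2 * h1 +
    latConst a q * thetaProd (z ^ a) (q ^ a) * h2

end ThetaConstant

/-- On the punctured unit disc, `g` is given by a power series with nonnegative coefficients. -/
def IsNonnegSeries (g : ℂ → ℂ) : Prop :=
  ∃ c : ℕ → ℝ, (∀ j, 0 ≤ c j) ∧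
    ∀ q : ℂ, ‖q‖ < 1 → q ≠ 0 → HasSum (fun j => (c j : ℂ) * q ^ j) (g q)

namespace IsNonnegSeries

variable {f g : ℂ → ℂ}

lemma congr (hf : IsNonnegSeries f) (h : ∀ q : ℂ, ‖q‖ < 1 → q ≠ 0 → f q = g q) :
    IsNonnegSeries g := by
  obtain ⟨c, hc, hs⟩ := hf
  exact ⟨c, hc, fun q hq hq0 => h q hq hq0 ▸ hs q hq hq0⟩

lemma one : IsNonnegSeries fun _ => 1 := by
  refine ⟨fun j => if j = 0 then 1 else 0, fun j => by positivity, fun q _ _ => ?_⟩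
  refine (congrArg (HasSum · _) (funext fun j => ?_)).mpr (hasSum_ite_eq 0 (1 : ℂ))
  split_ifs with h <;> simp [h]

lemma mul (hf : IsNonnegSeries f) (hg : IsNonnegSeries g) :
    IsNonnegSeries fun q => f q * g q := by
  obtain ⟨c, hc, hs⟩ := hf
  obtain ⟨d, hd, ht⟩ := hg
  refine ⟨fun n => ∑ k ∈ Finset.range (n + 1), c k * d (n - k),
    fun n => Finset.sum_nonneg fun k _ => mul_nonneg (hc _) (hd _), fun q hq hq0 => ?_⟩
  have h := hasSum_sum_range_mul_of_summable_norm (hs q hq hq0).summable.norm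
    (ht q hq hq0).summable.norm
  rw [(hs q hq hq0).tsum_eq, (ht q hq hq0).tsum_eq] at h
  refine (congrArg (HasSum · _) (funext fun n => ?_)).mpr h
  push_cast
  rw [Finset.sum_mul]
  refine Finset.sum_congr rfl fun k hk => ?_
  have h1 : q ^ n = q ^ k * q ^ (n - k) := by
    rw [← pow_add, Nat.add_sub_cancel' (Nat.lt_succ_iff.1 (Finset.mem_range.1 hk))]
  rw [h1]
  ring

lemma prod {ι : Type*} {s : Finset ι} {f : ι → ℂ → ℂ} (h : ∀ i ∈ s, IsNonnegSeries (f i)) :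
    IsNonnegSeries fun q => ∏ i ∈ s, f i q := by
  classical
  induction s using Finset.induction_on with
  | empty => simpa using one
  | insert i s hi ih =>
    simp only [Finset.prod_insert hi]
    exact (h i (by simp)).mul (ih fun j hj => h j (by simp [hj]))

lemma sum {ι : Type*} {s : Finset ι} {f : ι → ℂ → ℂ} (h : ∀ i ∈ s, IsNonnegSeries (f i)) :
    IsNonnegSeries fun q => ∑ i ∈ s, f i q := by
  choose! c hc hs using h
  refine ⟨fun j => ∑ i ∈ s, c i j, fun j => Finset.sum_nonneg fun i hi => hc i hi j,
    fun q hq hq0 => ?_⟩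
  simpa [Finset.sum_mul] using hasSum_sum fun i hi => hs i hi q hq hq0

lemma comp_pow (hf : IsNonnegSeries f) {k : ℕ} (hk : k ≠ 0) :
    IsNonnegSeries fun q => f (q ^ k) := by
  obtain ⟨c, hc, hs⟩ := hf
  refine ⟨fun n => if k ∣ n then c (n / k) else 0, fun n => ?_, fun q hq hq0 => ?_⟩
  · dsimp only
    split_ifs
    exacts [hc _, le_rfl]
  · have hinj : Function.Injective fun j : ℕ => k * j := mul_right_injective₀ hk
    refine (hinj.hasSum_iff fun n hn => ?_).1 ((congrArg (HasSum · _) (funext fun j => ?_)).mpr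
      (hs (q ^ k) (norm_pow_lt_one hq hk) (pow_ne_zero k hq0)))
    · have h : ¬k ∣ n := fun ⟨j, hj⟩ => hn ⟨j, hj.symm⟩
      simp [h]
    · simp [Nat.pos_of_ne_zero hk, pow_mul]

lemma of_exponents {ι : Type*} {p : ι → Prop} [DecidablePred p] {e : ι → ℤ}
    (he : ∀ i, p i → 0 ≤ e i)
    (h : ∀ q : ℂ, ‖q‖ < 1 → q ≠ 0 → HasSum (fun i => if p i then q ^ e i else 0) (g q)) :
    IsNonnegSeries g := by
  refine ⟨fun n => ∑' i, if (e i).toNat = n then if p i then (1 : ℝ) else 0 else 0,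
    fun n => tsum_nonneg fun i => by positivity, fun q hq hq0 => ?_⟩
  refine (congrArg (HasSum · _) (funext fun n => ?_)).mpr
    (hasSum_fiberwise_ite (h q hq hq0) fun i => (e i).toNat)
  rw [Complex.ofReal_tsum, ← tsum_mul_right]
  refine tsum_congr fun i => ?_
  split_ifs with h1 h2
  · rw [← h1, ← zpow_natCast, Int.toNat_of_nonneg (he i h2)]
    simp
  all_goals simp

end IsNonnegSeries

lemma isNonnegSeries_latConst (a : ℕ) [NeZero a] : IsNonnegSeries (latConst a) :=
  .of_exponents (p := fun x : ZMod a → ℤ => ∑ ρ, x ρ = 0) (fun x _ => latEnergy_nonneg x)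
    fun _ hq hq0 => (summable_latWeight hq hq0).hasSum

lemma isNonnegSeries_latTheta (a : ℕ) [NeZero a] {m r : ℕ} (hm : m ≠ 0) (hr : r ≤ m) :
    IsNonnegSeries fun q => latTheta a (q ^ m) (q ^ r) := by
  refine .sum fun ρ _ => .of_exponents (p := fun x : ZMod a → ℤ => ∑ ρ, x ρ = 0)
    (e := fun x => m * latEnergy x + r * latPos x ρ) (fun x _ => ?_) fun q hq hq0 => ?_
  · have h1 := latEnergy_nonneg x
    have h2 := latEnergy_nonneg (x + Pi.single ρ 1)
    rw [latEnergy_add_single] at h2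
    have h3 : (r : ℤ) ≤ m := by exact_mod_cast hr
    have h4 : (0 : ℤ) ≤ r := by positivity
    nlinarith
  · have hqm := norm_pow_lt_one hq hm
    refine (congrArg (HasSum · _) (funext fun x => ?_)).mpr
      (summable_latWeight_mul hqm (pow_ne_zero m hq0) (pow_ne_zero r hq0) ρ).hasSum
    rw [latWeight]
    split_ifs
    · rw [zpow_add₀ hq0, zpow_mul, zpow_mul, zpow_natCast, zpow_natCast]
    · rw [zero_mul]

section EtaQuotient

variable {q : ℂ}

/-- The eta quotient `E(q^{mn})^{mn - m - n} E(q^m) E(q^n) / E(q)`. -/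
noncomputable def etaQuotient (m n : ℕ) (q : ℂ) : ℂ :=
  Eprod (q ^ (m * n)) ^ ((m : ℤ) * n - m - n) * Eprod (q ^ m) * Eprod (q ^ n) / Eprod q

lemma etaQuotient_comm (m n : ℕ) (q : ℂ) : etaQuotient m n q = etaQuotient n m q := by
  rw [etaQuotient, etaQuotient, mul_comm m n, mul_comm (m : ℤ), sub_right_comm, mul_right_comm]

/-- The product of the theta products `(q^r; q^m)_∞ (q^{m-r}; q^m)_∞` over `1 ≤ r ≤ h`. -/
noncomputable def thetaProdRange (m h : ℕ) (q : ℂ) : ℂ :=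
  ∏ r ∈ Finset.range h, thetaProd (q ^ (r + 1)) (q ^ m)

lemma thetaProdRange_eq (hq0 : q ≠ 0) {m h d : ℕ} (hm : m = h + d + h + 1) :
    thetaProdRange m h q = (∏ r ∈ Finset.range h, qPoch (q * q ^ r) (q ^ m)) *
      ∏ r ∈ Finset.range h, qPoch (q * q ^ (h + d + r)) (q ^ m) := by
  rw [thetaProdRange, ← Finset.prod_range_reflect (fun r => qPoch (q * q ^ (h + d + r)) (q ^ m)),
    ← Finset.prod_mul_distrib]
  refine Finset.prod_congr rfl fun r hr => ?_
  have hr' := Finset.mem_range.1 hr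
  have h1 : q ^ m / q ^ (r + 1) = q * q ^ (h + d + (h - 1 - r)) := by
    rw [div_eq_iff (pow_ne_zero _ hq0), ← pow_succ', ← pow_add]
    congr 1
    lia
  rw [thetaProd, h1, pow_succ']

lemma thetaProdRange_odd (hq : ‖q‖ < 1) (hq0 : q ≠ 0) (h : ℕ) :
    thetaProdRange (2 * h + 1) h q * Eprod (q ^ (2 * h + 1)) = Eprod q := by
  rw [thetaProdRange_eq hq0 (d := 0) (by ring), ← qPoch_self q,
    ← prod_qPoch hq q (Nat.succ_ne_zero (2 * h)), Nat.succ_eq_add_one, Finset.prod_range_succ,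
    two_mul h, Finset.prod_range_add, ← pow_succ', qPoch_self]
  simp only [add_zero]

lemma thetaProdRange_even (hq : ‖q‖ < 1) (hq0 : q ≠ 0) (h : ℕ) :
    thetaProdRange (2 * (h + 1)) h q * Eprod (q ^ (h + 1)) = Eprod q := by
  have h1 := prod_qPoch (norm_pow_lt_one hq (k := h + 1) (by lia)) (q ^ (h + 1)) two_ne_zero
  have h2 : 2 * (h + 1) = h + 1 + h + 1 := by ring
  rw [Finset.prod_range_succ, Finset.prod_range_one, pow_zero, mul_one, pow_one, ← pow_two,
    ← pow_mul, qPoch_self, qPoch_self, mul_comm _ 2] at h1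
  rw [thetaProdRange_eq hq0 (d := 1) h2, ← h1, ← qPoch_self q,
    ← prod_qPoch hq q (a := 2 * (h + 1)) (by lia)]
  rw [congrArg Finset.range h2, Finset.prod_range_succ, Finset.prod_range_add, Finset.prod_range_succ,
    ← pow_succ', ← pow_succ', ← h2, qPoch_self]
  ring

/-- The product of the theta-type generating functions that matches `thetaProdRange`. -/
noncomputable def latThetaRange (m n h : ℕ) [NeZero n] (q : ℂ) : ℂ :=
  ∏ r ∈ Finset.range h, latTheta n (q ^ m) (q ^ (r + 1)) * latConst n (q ^ m)

lemma isNonnegSeries_latThetaRange {m n h : ℕ} [NeZero n] (hm : h < m) :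
    IsNonnegSeries (latThetaRange m n h) :=
  .prod fun r hr =>
    (isNonnegSeries_latTheta n (by lia) (by have := Finset.mem_range.1 hr; lia)).mul
      ((isNonnegSeries_latConst n).comp_pow (by lia))

lemma latThetaRange_mul (hq : ‖q‖ < 1) (hq0 : q ≠ 0) {m n : ℕ} [NeZero n] (hm : m ≠ 0) (h : ℕ) :
    latThetaRange m n h q * thetaProdRange m h q * Eprod (q ^ (m * n)) ^ (2 * h) =
      Eprod (q ^ (m * n)) ^ (2 * n * h) * thetaProdRange m h (q ^ n) := by
  have h1 (r : ℕ) := latTheta_mul_latConst (a := n) (norm_pow_lt_one hq hm)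
    (pow_ne_zero m hq0) (pow_ne_zero (r + 1) hq0)
  simp only [← pow_mul] at h1
  have h2 := Finset.prod_congr (s₁ := Finset.range h) rfl fun r _ => h1 r
  simp only [Finset.prod_mul_distrib, Finset.prod_const, Finset.card_range, ← pow_mul] at h2
  simp only [latThetaRange, thetaProdRange, Finset.prod_mul_distrib, Finset.prod_const,
    Finset.card_range, ← pow_mul, mul_comm n]
  exact h2

lemma isNonnegSeries_etaQuotient_odd (h n : ℕ) [NeZero n] :
    IsNonnegSeries (etaQuotient (2 * h + 1) n) := by
  refine (isNonnegSeries_latThetaRange (m := 2 * h + 1) (n := n) (h := h) (by lia)).congr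
    fun q hq hq0 => ?_
  have hn := NeZero.ne n
  have h1 := latThetaRange_mul hq hq0 (n := n) (Nat.succ_ne_zero (2 * h)) h
  have h2 := thetaProdRange_odd hq hq0 h
  have h3 := thetaProdRange_odd (norm_pow_lt_one hq hn) (pow_ne_zero n hq0) h
  rw [← pow_mul, mul_comm n] at h3
  have hE := Eprod_ne_zero hq
  have hEmn := Eprod_ne_zero (norm_pow_lt_one hq (k := (2 * h + 1) * n) (by positivity))
  have h4 : (((2 * h + 1 : ℕ) : ℤ) * n - (2 * h + 1 : ℕ) - n) =
      ((2 * n * h : ℕ) : ℤ) - (2 * h : ℕ) - 1 := by push_cast; ring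
  rw [etaQuotient, h4, zpow_sub₀ hEmn, zpow_sub₀ hEmn, zpow_natCast, zpow_natCast, zpow_one,
    eq_div_iff hE, ← h2, ← h3]
  simp only [Nat.succ_eq_add_one] at h1
  field_simp
  linear_combination Eprod (q ^ (2 * h + 1)) * h1

lemma isNonnegSeries_etaQuotient_even (h : ℕ) {n : ℕ} [NeZero n]
    (hn : IsNonnegSeries (etaQuotient 2 n)) : IsNonnegSeries (etaQuotient (2 * (h + 1)) n) := by
  refine ((isNonnegSeries_latThetaRange (m := 2 * (h + 1)) (n := n) (h := h) (by lia)).mul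
    (hn.comp_pow h.succ_ne_zero)).congr fun q hq hq0 => ?_
  have hn0 := NeZero.ne n
  have h1 := latThetaRange_mul hq hq0 (n := n) (m := 2 * (h + 1)) (by lia) h
  have h2 := thetaProdRange_even hq hq0 h
  have h3 := thetaProdRange_even (norm_pow_lt_one hq hn0) (pow_ne_zero n hq0) h
  rw [← pow_mul, mul_comm n] at h3
  have hE := Eprod_ne_zero hq
  have hEmn := Eprod_ne_zero (norm_pow_lt_one hq (k := 2 * (h + 1) * n) (by positivity))
  have hEM := Eprod_ne_zero (norm_pow_lt_one hq (k := h + 1) (by positivity))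
  have h4 : (((2 * (h + 1) : ℕ) : ℤ) * n - (2 * (h + 1) : ℕ) - n) =
      ((2 * n * h : ℕ) : ℤ) - (2 * h : ℕ) + (((2 : ℕ) : ℤ) * n - (2 : ℕ) - n) := by
    push_cast
    ring
  have h5 : (h + 1) * (2 * n) = 2 * (h + 1) * n := by ring
  rw [etaQuotient, etaQuotient, h4, zpow_add₀ hEmn, zpow_sub₀ hEmn, zpow_natCast, zpow_natCast,
    eq_div_iff hE, ← h2, ← h3]
  simp only [Nat.succ_eq_add_one, ← pow_mul, h5, mul_comm (h + 1) 2]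
  field_simp
  linear_combination Eprod (q ^ (2 * (h + 1))) * Eprod (q ^ ((h + 1) * n)) * h1

lemma isNonnegSeries_etaQuotient_two_two : IsNonnegSeries (etaQuotient 2 2) := by
  refine (isNonnegSeries_latConst 2).congr fun q hq hq0 => ?_
  rw [etaQuotient, eq_div_iff (Eprod_ne_zero hq), latConst_mul_Eprod hq hq0]
  norm_num [sq]

lemma isNonnegSeries_etaQuotient {m n : ℕ} (hm : 0 < m) (hn : 0 < n) :
    IsNonnegSeries (etaQuotient m n) := by
  have two (k : ℕ) (hk : 0 < k) : IsNonnegSeries (etaQuotient 2 k) := by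
    refine IsNonnegSeries.congr ?_ fun q _ _ => etaQuotient_comm k 2 q
    obtain ⟨h, rfl | rfl⟩ := k.even_or_odd'
    · obtain ⟨h, rfl⟩ := Nat.exists_eq_succ_of_ne_zero (by lia : h ≠ 0)
      exact isNonnegSeries_etaQuotient_even h isNonnegSeries_etaQuotient_two_two
    · exact isNonnegSeries_etaQuotient_odd h 2
  have : NeZero n := ⟨hn.ne'⟩
  obtain ⟨h, rfl | rfl⟩ := m.even_or_odd'
  · obtain ⟨h, rfl⟩ := Nat.exists_eq_succ_of_ne_zero (by lia : h ≠ 0)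
    exact isNonnegSeries_etaQuotient_even h (two n hn)
  · exact isNonnegSeries_etaQuotient_odd h n

lemma continuousAt_Eprod_zero : ContinuousAt Eprod 0 :=
  (ModularForm.differentiableOn_tprod_one_sub_pow.continuousOn).continuousAt
    (Metric.ball_mem_nhds 0 one_pos)

lemma continuousAt_etaQuotient_zero {m n : ℕ} (hm : 0 < m) (hn : 0 < n) :
    ContinuousAt (etaQuotient m n) 0 := by
  have h (k : ℕ) (hk : k ≠ 0) : ContinuousAt (fun q : ℂ => Eprod (q ^ k)) 0 :=
    ContinuousAt.comp (g := Eprod) (f := fun q => q ^ k)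
      (by simpa [hk] using continuousAt_Eprod_zero) (continuous_pow k).continuousAt
  have h0 := Eprod_ne_zero (q := 0) (by simp)
  have hmn := (Nat.mul_pos hm hn).ne'
  exact ((((h _ hmn).zpow₀ _ (.inl (by simpa [hmn] using h0))).mul (h _ hm.ne')).mul
    (h _ hn.ne')).div continuousAt_Eprod_zero h0

lemma continuousAt_tsum_mul_pow_zero {c : ℕ → ℂ} (hc : Summable fun j => c j * (1 / 2) ^ j) :
    ContinuousAt (fun q : ℂ => ∑' j, c j * q ^ j) 0 := by
  refine tendsto_tsum_of_dominated_convergence hc.norm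
    (fun j => ((continuous_pow j).tendsto 0).const_mul _) ?_
  filter_upwards [Metric.closedBall_mem_nhds (0 : ℂ) (by norm_num : (0 : ℝ) < 1 / 2)] with q hq j
  rw [mem_closedBall_zero_iff] at hq
  simp only [norm_mul, norm_pow]
  gcongr
  simpa using hq

end EtaQuotient

/-- For all positive integers `m` and `n`, the series
`E(q^{mn})^{mn - m - n} E(q^m) E(q^n) / E(q)` has nonnegative coefficients. -/
theorem eta_quotient_nonneg (m n : ℕ) (hm : 0 < m) (hn : 0 < n) :
    ∃ c : ℕ → ℝ, (∀ j, 0 ≤ c j) ∧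
      ∀ q : ℂ, ‖q‖ < 1 →
        Eprod (q ^ (m * n)) ^ ((m : ℤ) * n - m - n) *
            Eprod (q ^ m) * Eprod (q ^ n) / Eprod q =
          ∑' j : ℕ, (c j : ℂ) * q ^ j := by
  obtain ⟨c, hc, hs⟩ := isNonnegSeries_etaQuotient hm hn
  refine ⟨c, hc, fun q hq => ?_⟩
  change etaQuotient m n q = _
  rcases eq_or_ne q 0 with rfl | hq0
  · have hball : Metric.ball (0 : ℂ) 1 ∈ 𝓝[≠] 0 :=
      nhdsWithin_le_nhds (Metric.ball_mem_nhds 0 one_pos)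
    have h1 : Tendsto (etaQuotient m n) (𝓝[≠] 0) (𝓝 (etaQuotient m n 0)) :=
      (continuousAt_etaQuotient_zero hm hn).tendsto.mono_left nhdsWithin_le_nhds
    have h2 := (continuousAt_tsum_mul_pow_zero (hs (1 / 2) (by norm_num) (by norm_num)).summable
      ).tendsto.mono_left (nhdsWithin_le_nhds (s := {0}ᶜ))
    refine tendsto_nhds_unique h1 (h2.congr' ?_)
    filter_upwards [self_mem_nhdsWithin, hball] with q hq0 hq
    exact (hs q (by simpa using hq) hq0).tsum_eq
  · exact (hs q hq hq0).tsum_eq.symm
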